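/- Let X be an abelian group (written multiplicatively) equipped with a linear order compatible with the group operation, and set X_+ := {χ ∈ X : χ ≥ 1}. Suppose X_+ \ {1} has a least element χ₁, and let X^i denote the cyclic subgroup of X generated by χ₁. Then for every integer k ∈ ℤ, the set χ₁^k · (X_+ \ X^i) := {χ₁^k ξ : ξ ∈ X_+ \ X^i} equals X_+ \ X^i. -/

import Mathlib

/-- If `a` is the least element greater than `1`, then every `x ≥ 1` outside the cyclic subgroup
generated by `a` dominates every power of `a`. -/
theorem one_le_zpow_mul_of_notMem_zpowers {G : Type*} [CommGroup G] [LinearOrder G]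
    [MulLeftMono G] {a : G} (ha : IsLeast {x : G | 1 ≤ x ∧ x ≠ 1} a) {x : G}
    (hx : 1 ≤ x) (hxa : x ∉ Subgroup.zpowers a) (k : ℤ) : 1 ≤ a ^ k * x := by
  have hmem (m : ℤ) : a ^ m * x ∉ Subgroup.zpowers a := fun h =>
    hxa ((Subgroup.mul_mem_cancel_left _ (Subgroup.zpow_mem_zpowers a m)).1 h)
  induction k with
  | zero => simpa using hx
  | succ n ih =>
    rw [add_comm, zpow_one_add, mul_assoc]
    exact one_le_mul ha.1.1 ih
  | pred n ih =>
    have hle : a ≤ a ^ (-(n : ℤ)) * x :=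
      ha.2 ⟨ih, fun h => hmem _ (h ▸ Subgroup.one_mem _)⟩
    rw [sub_eq_neg_add, zpow_add, zpow_neg_one, mul_assoc]
    exact le_inv_mul_iff_mul_le.2 (by simpa using hle)


/-- **Lemma 1.1(2).** Let `X` be an abelian group with a linear order compatible with the
group operation, `X_+ := {χ : 1 ≤ χ}`. If `X_+ \ {1}` has a least element `χ₁` and `Xⁱ` is the
cyclic subgroup generated by `χ₁`, then for every `k : ℤ`,
`χ₁ ^ k • (X_+ \ Xⁱ) = X_+ \ Xⁱ`. -/
theorem stmt1 {X : Type*} [CommGroup X] [LinearOrder X]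
    [CovariantClass X X (· * ·) (· ≤ ·)]
    (χ₁ : X) (hχ₁ : IsLeast {χ : X | 1 ≤ χ ∧ χ ≠ 1} χ₁)
    (k : ℤ) :
    (fun ξ : X => χ₁ ^ k * ξ) '' ({χ : X | 1 ≤ χ} \ (Subgroup.zpowers χ₁ : Set X)) =
      {χ : X | 1 ≤ χ} \ (Subgroup.zpowers χ₁ : Set X) := by
  have hmaps (m : ℤ) (ξ : X) (hξ : ξ ∈ {χ : X | 1 ≤ χ} \ (Subgroup.zpowers χ₁ : Set X)) :
      χ₁ ^ m * ξ ∈ {χ : X | 1 ≤ χ} \ (Subgroup.zpowers χ₁ : Set X) :=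
    ⟨one_le_zpow_mul_of_notMem_zpowers hχ₁ hξ.1 hξ.2 m, fun h =>
      hξ.2 ((Subgroup.mul_mem_cancel_left _ (Subgroup.zpow_mem_zpowers χ₁ m)).1 h)⟩
  refine Set.Subset.antisymm (Set.image_subset_iff.2 (hmaps k)) fun ξ hξ => ?_
  exact ⟨χ₁ ^ (-k) * ξ, hmaps (-k) ξ hξ, by simp⟩
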